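/- Let P = ⟨H,M,T⟩ be an abduction problem with H = {h₁,…,hₙ}, and let C = {c₁,…,cₙ}, D = {d₁,…,dₙ}, E = {e₁,…,eₙ} be sets of fresh propositional variables in one-to-one correspondence with H. Define P' = ⟨H',M',T'⟩ by H' = C ∪ D, M' = M ∪ E, and T' = { cᵢ → hᵢ, cᵢ → eᵢ, dᵢ → eᵢ : 1 ≤ i ≤ n } ∪ T. If H₁ ∈ SOL(P), then the set { cᵢ : hᵢ ∈ H₁ } ∪ { dᵢ : hᵢ ∉ H₁ } is a minimum-cardinality solution of P', i.e. it belongs to SOL_≤(P'). -/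

import Mathlib

/-- Propositional formulas over a set `V` of variables. -/
inductive PropForm (V : Type) : Type where
  | fls  : PropForm V
  | var  : V → PropForm V
  | neg  : PropForm V → PropForm V
  | conj : PropForm V → PropForm V → PropForm V
  | disj : PropForm V → PropForm V → PropForm V
  | imp  : PropForm V → PropForm V → PropForm V
  deriving DecidableEq

namespace PropForm

/-- Truth of a formula under a valuation. -/
def eval {V : Type} (v : V → Prop) : PropForm V → Prop
  | fls => False
  | var x => v x
  | neg φ => ¬ eval v φ
  | conj φ ψ => eval v φ ∧ eval v ψ
  | disj φ ψ => eval v φ ∨ eval v ψ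
  | imp φ ψ => eval v φ → eval v ψ

/-- The set of variables occurring in a formula. -/
def vars {V : Type} : PropForm V → Set V
  | fls => ∅
  | var x => {x}
  | neg φ => vars φ
  | conj φ ψ => vars φ ∪ vars ψ
  | disj φ ψ => vars φ ∪ vars ψ
  | imp φ ψ => vars φ ∪ vars ψ

end PropForm

/-- An abduction problem `⟨H, M, T⟩`: hypotheses, manifestations, theory. -/
structure AbdProblem (V : Type) [DecidableEq V] : Type where
  H : Finset V
  M : Finset V
  T : Finset (PropForm V)

variable {V : Type} [DecidableEq V]

/-- `v` is a model of the hypotheses `A` together with the theory `T`. -/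
def models (v : V → Prop) (A : Finset V) (T : Finset (PropForm V)) : Prop :=
  (∀ x ∈ A, v x) ∧ (∀ φ ∈ T, φ.eval v)

/-- `A` is a solution of `P`: `A ⊆ H`, `A ∪ T` is satisfiable, `A ∪ T ⊨ m` for `m ∈ M`. -/
def isSol (P : AbdProblem V) (A : Finset V) : Prop :=
  A ⊆ P.H ∧ (∃ v, models v A P.T) ∧ ∀ v, models v A P.T → ∀ m ∈ P.M, v m

/-- The set of solutions of `P`. -/
def SOL (P : AbdProblem V) : Set (Finset V) := {A | isSol P A}

/-- The solutions of `P` minimal under set inclusion. -/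
def SOLsub (P : AbdProblem V) : Set (Finset V) :=
  {A | A ∈ SOL P ∧ ∀ B ∈ SOL P, B ⊆ A → B = A}

/-- The solutions of `P` of minimum cardinality. -/
def SOLcard (P : AbdProblem V) : Set (Finset V) :=
  {A | A ∈ SOL P ∧ ∀ B ∈ SOL P, A.card ≤ B.card}

/-- `x` is fresh for `P`: it occurs neither in `H`, nor in `M`, nor in any formula of `T`. -/
def freshFor (P : AbdProblem V) (x : V) : Prop :=
  x ∉ P.H ∧ x ∉ P.M ∧ ∀ φ ∈ P.T, x ∉ φ.vars

/-- The problem `P' = ⟨C ∪ D, M ∪ E, {cᵢ → hᵢ, cᵢ → eᵢ, dᵢ → eᵢ : i} ∪ T⟩`. -/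
def splitProb (P : AbdProblem V) {n : ℕ} (h c d e : Fin n → V) : AbdProblem V where
  H := Finset.univ.image c ∪ Finset.univ.image d
  M := P.M ∪ Finset.univ.image e
  T := Finset.univ.image (fun i => PropForm.imp (PropForm.var (c i)) (PropForm.var (h i)))
    ∪ Finset.univ.image (fun i => PropForm.imp (PropForm.var (c i)) (PropForm.var (e i)))
    ∪ Finset.univ.image (fun i => PropForm.imp (PropForm.var (d i)) (PropForm.var (e i)))
    ∪ P.T

theorem PropForm.eval_congr {V : Type} {v w : V → Prop} (φ : PropForm V)
    (hvw : ∀ x ∈ φ.vars, v x ↔ w x) : φ.eval v ↔ φ.eval w := by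
  induction φ with
  | fls => exact Iff.rfl
  | var x => exact hvw x rfl
  | neg φ ih => exact not_congr (ih hvw)
  | conj φ ψ ih₁ ih₂ =>
    exact and_congr (ih₁ fun x hx => hvw x (Or.inl hx)) (ih₂ fun x hx => hvw x (Or.inr hx))
  | disj φ ψ ih₁ ih₂ =>
    exact or_congr (ih₁ fun x hx => hvw x (Or.inl hx)) (ih₂ fun x hx => hvw x (Or.inr hx))
  | imp φ ψ ih₁ ih₂ =>
    exact imp_congr (ih₁ fun x hx => hvw x (Or.inl hx)) (ih₂ fun x hx => hvw x (Or.inr hx))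

theorem models_splitProb_iff (P : AbdProblem V) {n : ℕ} (h c d e : Fin n → V)
    (v : V → Prop) (A : Finset V) :
    models v A (splitProb P h c d e).T ↔
      (∀ x ∈ A, v x) ∧ (∀ i, v (c i) → v (h i)) ∧ (∀ i, v (c i) → v (e i)) ∧
        (∀ i, v (d i) → v (e i)) ∧ ∀ φ ∈ P.T, φ.eval v := by
  simp only [models, splitProb, Finset.mem_union, Finset.mem_image, Finset.mem_univ, true_and,
    or_imp, forall_and, forall_exists_index, forall_apply_eq_imp_iff, PropForm.eval, and_assoc]

/-- Valuations that agree on the variables that are not fresh agree on the theory. -/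
theorem forall_eval_of_agree_off_fresh {P : AbdProblem V} {v w : V → Prop}
    (hvw : ∀ x, ¬ freshFor P x → (v x ↔ w x)) (hv : ∀ φ ∈ P.T, φ.eval v) :
    ∀ φ ∈ P.T, φ.eval w := fun φ hφ =>
  (φ.eval_congr fun x hx => hvw x fun hf => hf.2.2 φ hφ hx).1 (hv φ hφ)

/-- Every solution of the split problem contains `c i` or `d i`, since `e i` has to be derived. -/
theorem mem_or_mem_of_mem_SOL_splitProb {P : AbdProblem V} {n : ℕ} {h c d e : Fin n → V}
    (hH : ∀ i, h i ∈ P.H)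
    (einj : Function.Injective e)
    (cfresh : ∀ i, freshFor P (c i)) (dfresh : ∀ i, freshFor P (d i))
    (efresh : ∀ i, freshFor P (e i))
    (ce : ∀ i j, c i ≠ e j) (de : ∀ i j, d i ≠ e j)
    {B : Finset V} (hB : B ∈ SOL (splitProb P h c d e)) (i : Fin n) : c i ∈ B ∨ d i ∈ B := by
  by_contra! hi
  obtain ⟨hBH, ⟨v, hv⟩, hent⟩ := hB
  obtain ⟨hvB, hch, hce, hde, hT⟩ := (models_splitProb_iff P h c d e v B).1 hv
  have heB : e i ∉ B := by
    intro hmem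
    have := hBH hmem
    simp only [splitProb, Finset.mem_union, Finset.mem_image, Finset.mem_univ, true_and] at this
    rcases this with ⟨j, hj⟩ | ⟨j, hj⟩
    · exact ce j i hj
    · exact de j i hj
  let w : V → Prop := fun x => v x ∧ x ≠ c i ∧ x ≠ d i ∧ x ≠ e i
  have hagree : ∀ x, ¬ freshFor P x → (v x ↔ w x) := fun x hx =>
    ⟨fun hvx => ⟨hvx, fun hxc => hx (hxc ▸ cfresh i), fun hxd => hx (hxd ▸ dfresh i),
      fun hxe => hx (hxe ▸ efresh i)⟩, And.left⟩
  have hw : models w B (splitProb P h c d e).T := by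
    refine (models_splitProb_iff P h c d e w B).2 ⟨fun x hx => ⟨hvB x hx, ?_, ?_, ?_⟩,
      fun j hj => (hagree _ fun hf => hf.1 (hH j)).1 (hch j hj.1),
      fun j hj => ⟨hce j hj.1, (ce i j).symm, (de i j).symm, fun hji => ?_⟩,
      fun j hj => ⟨hde j hj.1, (ce i j).symm, (de i j).symm, fun hji => ?_⟩,
      forall_eval_of_agree_off_fresh hagree hT⟩
    · rintro rfl; exact hi.1 hx
    · rintro rfl; exact hi.2 hx
    · rintro rfl; exact heB hx
    · exact hj.2.1 (congrArg c (einj hji))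
    · exact hj.2.2.1 (congrArg d (einj hji))
  exact (hent w hw (e i) (by simp [splitProb])).2.2.2 rfl

theorem split_image_of_solution_is_min (P : AbdProblem V) (n : ℕ) (h c d e : Fin n → V)
    (hH : P.H = Finset.univ.image h)
    (hinj : Function.Injective h) (cinj : Function.Injective c)
    (dinj : Function.Injective d) (einj : Function.Injective e)
    (cfresh : ∀ i, freshFor P (c i)) (dfresh : ∀ i, freshFor P (d i))
    (efresh : ∀ i, freshFor P (e i))
    (cd : ∀ i j, c i ≠ d j) (ce : ∀ i j, c i ≠ e j) (de : ∀ i j, d i ≠ e j)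
    (H₁ : Finset V) (hH₁ : H₁ ∈ SOL P) :
    (Finset.univ.filter (fun i => h i ∈ H₁)).image c
      ∪ (Finset.univ.filter (fun i => h i ∉ H₁)).image d
      ∈ SOLcard (splitProb P h c d e) := by
  classical
  obtain ⟨hsub, ⟨v, hvH, hvT⟩, hent⟩ := hH₁
  have hmem : ∀ i, h i ∈ P.H := fun i => by simp [hH]
  set S := (Finset.univ.filter (fun i => h i ∈ H₁)).image c
      ∪ (Finset.univ.filter (fun i => h i ∉ H₁)).image d with hS
  have mem_S : ∀ x, x ∈ S ↔ (∃ i, h i ∈ H₁ ∧ c i = x) ∨ ∃ i, h i ∉ H₁ ∧ d i = x := by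
    simp [hS]
  have c_mem_S : ∀ i, c i ∈ S → h i ∈ H₁ := by
    intro i hi
    rcases (mem_S _).1 hi with ⟨j, hj, hji⟩ | ⟨j, -, hji⟩
    · exact cinj hji ▸ hj
    · exact absurd hji.symm (cd i j)
  refine ⟨⟨?_, ?_, ?_⟩, fun B hB => ?_⟩
  · exact Finset.union_subset_union (Finset.image_subset_image (Finset.subset_univ _))
      (Finset.image_subset_image (Finset.subset_univ _))
  · let w : V → Prop := fun x => if freshFor P x then x ∈ S ∨ ∃ i, x = e i else v x
    have hagree : ∀ x, ¬ freshFor P x → (v x ↔ w x) := fun x hx => by simp [w, hx]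
    have he : ∀ i, w (e i) := fun i => by simp [w, efresh i]
    refine ⟨w, (models_splitProb_iff P h c d e w S).2 ⟨fun x hx => ?_, fun i hi => ?_,
      fun i _ => he i, fun i _ => he i, forall_eval_of_agree_off_fresh hagree hvT⟩⟩
    · have hf : freshFor P x := by
        rcases (mem_S x).1 hx with ⟨i, -, rfl⟩ | ⟨i, -, rfl⟩
        · exact cfresh i
        · exact dfresh i
      simp [w, hf, hx]
    · refine (hagree _ fun hf => hf.1 (hmem i)).1 (hvH _ (c_mem_S i ?_))
      simpa [w, cfresh i, ce i] using hi
  · intro w hw m hm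
    obtain ⟨hwS, hch, hce, hde, hT⟩ := (models_splitProb_iff P h c d e w S).1 hw
    rcases Finset.mem_union.1 hm with hm | hm
    · refine hent w ⟨fun x hx => ?_, hT⟩ m hm
      have hxH := hsub hx
      rw [hH] at hxH
      obtain ⟨i, -, rfl⟩ := Finset.mem_image.1 hxH
      exact hch i (hwS _ ((mem_S _).2 (Or.inl ⟨i, hx, rfl⟩)))
    · obtain ⟨i, -, rfl⟩ := Finset.mem_image.1 hm
      by_cases hi : h i ∈ H₁
      · exact hce i (hwS _ ((mem_S _).2 (Or.inl ⟨i, hi, rfl⟩)))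
      · exact hde i (hwS _ ((mem_S _).2 (Or.inr ⟨i, hi, rfl⟩)))
  · have hcover := mem_or_mem_of_mem_SOL_splitProb hmem einj cfresh dfresh efresh
      ce de hB
    calc S.card
        ≤ (Finset.univ.filter (fun i => h i ∈ H₁)).card
          + (Finset.univ.filter (fun i => h i ∉ H₁)).card :=
          (Finset.card_union_le _ _).trans
            (Nat.add_le_add Finset.card_image_le Finset.card_image_le)
      _ = (Finset.univ : Finset (Fin n)).card :=
          Finset.card_filter_add_card_filter_not _
      _ ≤ B.card := by
          refine Finset.card_le_card_of_injOn (fun i => if c i ∈ B then c i else d i) ?_ ?_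
          · intro i _
            have := hcover i
            by_cases hi : c i ∈ B <;> simp_all
          · intro i _ j _ hij
            dsimp only at hij
            split_ifs at hij
            · exact cinj hij
            · exact absurd hij (cd i j)
            · exact absurd hij.symm (cd j i)
            · exact dinj hij
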